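/- arXiv:1503.02346 — 3 statements merged into one kernel-verified Lean document; each statement's English description precedes it below -/
import Mathlib

section
/- For every real b > 0 and every real t ≥ 0, the function u ↦ (1−u^b)^t is integrable on (0,1) and ∫_0^1 (1−u^b)^t du = ∑_{n=0}^∞ (−1)^n C(t,n)/(nb+1), where the series on the right converges; here C(t,n) = (∏_{l=0}^{n−1}(t−l))/n! is the generalized binomial coefficient. -/
open MeasureTheory

/-- The generalized binomial coefficient `C(t,n) = (∏_{l=0}^{n−1}(t−l))/n!`. -/
noncomputable def genC (t : ℝ) (n : ℕ) : ℝ :=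
  (∏ l ∈ Finset.range n, (t - l)) / (n.factorial : ℝ)

theorem genC_eq_choose (t : ℝ) (n : ℕ) : genC t n = Ring.choose t n := by
  rw [genC, Ring.choose_eq_smul, Polynomial.descPochhammer_smeval_eq_ascPochhammer,
    Polynomial.ascPochhammer_smeval_eq_eval, ← descPochhammer_eval_eq_ascPochhammer,
    descPochhammer_eval_eq_prod_range, smul_eq_mul, div_eq_inv_mul]

theorem genC_succ_mul (t : ℝ) (n : ℕ) : genC t (n + 1) * (n + 1) = genC t n * (t - n) := by
  have h : (n.factorial : ℝ) ≠ 0 := by positivity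
  rw [genC, genC, Finset.prod_range_succ, Nat.factorial_succ]
  push_cast
  field_simp

theorem summable_abs_genC {t : ℝ} (ht : 0 ≤ t) : Summable fun n => |genC t n| := by
  rcases ht.eq_or_lt with rfl | ht
  · refine summable_of_ne_finset_zero (s := {0}) fun n hn => ?_
    have hn : n ≠ 0 := by simpa using hn
    rw [abs_eq_zero, genC, Finset.prod_eq_zero (Finset.mem_range.2 hn.bot_lt) (by simp), zero_div]
  · obtain ⟨N, hN⟩ := exists_nat_ge t
    rw [← summable_nat_add_iff N]
    have telescope (n : ℕ) : t * |genC t (n + N)| =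
        ↑(n + N) * |genC t (n + N)| - ↑(n + 1 + N) * |genC t (n + 1 + N)| := by
      have h := congrArg abs (genC_succ_mul t (n + N))
      have hle : t - ↑(n + N) ≤ 0 := by push_cast; linarith [n.cast_nonneg (α := ℝ)]
      rw [abs_mul, abs_mul, abs_of_nonpos hle,
        abs_of_nonneg (by positivity : (0 : ℝ) ≤ ↑(n + N) + 1)] at h
      rw [show n + 1 + N = n + N + 1 by ring, Nat.cast_succ]
      linarith
    refine summable_of_sum_range_le (c := N * |genC t N| / t) (fun _ => abs_nonneg _) fun n => ?_
    rw [le_div_iff₀' ht, Finset.mul_sum, Finset.sum_congr rfl fun i _ => telescope i,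
      Finset.sum_range_sub' fun i : ℕ => ((i + N : ℕ) : ℝ) * |genC t (i + N)|, zero_add]
    exact sub_le_self _ (by positivity)

theorem hasSum_one_sub_rpow (t : ℝ) {x : ℝ} (hx : |x| < 1) :
    HasSum (fun n : ℕ => (-1) ^ n * genC t n * x ^ n) ((1 - x) ^ t) := by
  have h := (Real.one_add_rpow_hasFPowerSeriesOnBall_zero (a := t)).hasSum (y := -x)
    (by simpa [edist_dist] using hx)
  convert! h using 1
  · funext n
    rw [binomialSeries_apply, genC_eq_choose, List.ofFn_const, List.prod_replicate, neg_pow x,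
      smul_eq_mul]
    ring
  · ring_nf

theorem integral_Ioo_rpow {r : ℝ} (hr : 0 ≤ r) :
    ∫ u in Set.Ioo (0 : ℝ) 1, u ^ r = 1 / (r + 1) := by
  rw [← integral_Ioc_eq_integral_Ioo, ← intervalIntegral.integral_of_le zero_le_one,
    integral_rpow (Or.inl (by linarith)), Real.one_rpow, Real.zero_rpow (by linarith), sub_zero]

theorem integrableOn_Ioo_rpow {r : ℝ} (hr : 0 ≤ r) :
    IntegrableOn (fun u : ℝ => u ^ r) (Set.Ioo 0 1) :=
  ((Real.continuous_rpow_const hr).integrableOn_Icc).mono_set Set.Ioo_subset_Icc_self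

/-- For `b > 0` and `t ≥ 0`, `u ↦ (1-u^b)^t` is integrable on `(0,1)`,
the series `∑ₙ (−1)^n C(t,n)/(nb+1)` converges, and
`∫_0^1 (1−u^b)^t du = ∑_{n=0}^∞ (−1)^n C(t,n)/(nb+1)`. -/
theorem integral_one_sub_rpow_eq_tsum (b t : ℝ) (hb : 0 < b) (ht : 0 ≤ t) :
    IntegrableOn (fun u : ℝ => (1 - u ^ b) ^ t) (Set.Ioo 0 1) volume ∧
    Summable (fun n : ℕ => (-1 : ℝ) ^ n * genC t n / (n * b + 1)) ∧
    ∫ u in Set.Ioo (0:ℝ) 1, (1 - u ^ b) ^ t = ∑' n : ℕ, (-1 : ℝ) ^ n * genC t n / (n * b + 1) := by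
  have hnb (n : ℕ) : 0 ≤ n * b := by positivity
  have integral_norm (n : ℕ) : ∫ u in Set.Ioo (0 : ℝ) 1, ‖(-1) ^ n * genC t n * u ^ (n * b)‖ =
      |genC t n| / (n * b + 1) := by
    rw [setIntegral_congr_fun (g := fun u => |genC t n| * u ^ (n * b)) measurableSet_Ioo,
      integral_const_mul, integral_Ioo_rpow (hnb n), mul_one_div]
    intro u hu
    simp [abs_of_nonneg (Real.rpow_nonneg hu.1.le _)]
  have summable_norm : Summable fun n : ℕ => |genC t n| / (n * b + 1) :=
    (summable_abs_genC ht).of_nonneg_of_le (fun n => div_nonneg (abs_nonneg _) (by linarith [hnb n]))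
      fun n => div_le_self (abs_nonneg _) (by linarith [hnb n])
  have h := hasSum_integral_of_summable_integral_norm
    (μ := volume.restrict (Set.Ioo (0 : ℝ) 1))
    (F := fun (n : ℕ) u => (-1) ^ n * genC t n * u ^ (n * b))
    (fun n => (integrableOn_Ioo_rpow (hnb n)).const_mul _)
    (by simpa only [integral_norm] using summable_norm)
  simp only [integral_const_mul, integral_Ioo_rpow (hnb _), mul_one_div] at h
  have pointwise : ∀ u ∈ Set.Ioo (0 : ℝ) 1,
      ∑' n : ℕ, (-1) ^ n * genC t n * u ^ (n * b) = (1 - u ^ b) ^ t := by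
    intro u hu
    have hub : |u ^ b| < 1 := by
      rw [abs_of_nonneg (Real.rpow_nonneg hu.1.le _)]
      exact Real.rpow_lt_one hu.1.le hu.2 hb
    rw [← (hasSum_one_sub_rpow t hub).tsum_eq]
    refine tsum_congr fun n => ?_
    rw [mul_comm (n : ℝ) b, Real.rpow_mul hu.1.le, Real.rpow_natCast]
  rw [setIntegral_congr_fun measurableSet_Ioo pointwise] at h
  refine ⟨?_, h.summable, h.tsum_eq.symm⟩
  have hcont : Continuous fun u : ℝ => (1 - u ^ b) ^ t :=
    (Real.continuous_rpow_const ht).comp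
      (continuous_const.sub (Real.continuous_rpow_const hb.le))
  exact hcont.integrableOn_Icc.mono_set Set.Ioo_subset_Icc_self
end

section
/- For every real b > 0 and every real t with 0 < t < 1, ∫_0^∞ e^{−w} ( ∫_{e^{−w/b}}^1 [ (1−u^b)^{−t} − (1+u^b)^{−t} ] du ) dw = 2 ∑_{n odd, n≥1} D(t,n)/((n+1)b+1), where D(t,n) = (∏_{l=0}^{n−1}(t+l))/n!, the outer sum is over odd integers n ≥ 1, the iterated integral is well defined, and the series converges. -/
open MeasureTheory

/-- `D(t,n) = (∏_{l=0}^{n−1}(t+l))/n!`. -/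
noncomputable def genD (t : ℝ) (n : ℕ) : ℝ :=
  (∏ l ∈ Finset.range n, (t + l)) / (n.factorial : ℝ)

/-- Termwise integration of an almost everywhere convergent series of nonnegative functions. -/
lemma integrable_and_hasSum_integral_of_nonneg {α : Type*} [MeasurableSpace α] {μ : Measure α}
    {F : ℕ → α → ℝ} {g : α → ℝ} (hF : ∀ i, Integrable (F i) μ) (hF0 : ∀ i, 0 ≤ᵐ[μ] F i)
    (hg : ∀ᵐ a ∂μ, HasSum (fun i => F i a) (g a)) (hsum : Summable fun i => ∫ a, F i a ∂μ) :
    Integrable g μ ∧ HasSum (fun i => ∫ a, F i a ∂μ) (∫ a, g a ∂μ) := by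
  have hnorm : ∀ i, ∫ a, ‖F i a‖ ∂μ = ∫ a, F i a ∂μ := fun i =>
    integral_congr_ae ((hF0 i).mono fun a ha => Real.norm_of_nonneg ha)
  have htsum : (fun a => ∑' i, F i a) =ᵐ[μ] g := hg.mono fun a ha => ha.tsum_eq
  refine ⟨⟨?_, ?_⟩, ?_⟩
  · refine aestronglyMeasurable_of_tendsto_ae (u := Filter.atTop)
      (f := fun n a => ∑ i ∈ Finset.range n, F i a) (fun n => ?_)
      (hg.mono fun a ha => ha.tendsto_sum_nat)
    exact Finset.aestronglyMeasurable_fun_sum _ fun i _ => (hF i).1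
  · have hle : ∫⁻ a, ‖g a‖ₑ ∂μ ≤ ∫⁻ a, ∑' i, ENNReal.ofReal (F i a) ∂μ := by
      refine lintegral_mono_ae ?_
      filter_upwards [hg, ae_all_iff.2 hF0] with a ha h0
      rw [← ENNReal.ofReal_tsum_of_nonneg h0 ha.summable, ha.tsum_eq,
        Real.enorm_of_nonneg (ha.nonneg h0)]
    refine hle.trans_lt ?_
    rw [lintegral_tsum fun i => (hF i).1.aemeasurable.ennreal_ofReal]
    simp_rw [← ofReal_integral_eq_lintegral_ofReal (hF _) (hF0 _)]
    exact hsum.tsum_ofReal_lt_top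
  · rw [← integral_congr_ae htsum]
    exact hasSum_integral_of_summable_integral_norm hF (by simpa only [hnorm] using hsum)

lemma genD_nonneg {t : ℝ} (ht : 0 < t) (n : ℕ) : 0 ≤ genD t n := by
  unfold genD; positivity

lemma genD_succ (t : ℝ) (n : ℕ) : genD t (n + 1) = genD t n * (t + n) / (n + 1) := by
  simp only [genD, Finset.prod_range_succ, Nat.factorial_succ]
  push_cast
  field_simp

lemma genD_eq_choose (t : ℝ) (n : ℕ) : genD t n = Ring.choose (t + n - 1) n := by
  rw [← Ring.multichoose_eq]
  have h := Ring.factorial_nsmul_multichoose_eq_ascPochhammer t n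
  have hprod : (ascPochhammer ℝ n).eval t = ∏ l ∈ Finset.range n, (t + l) := by
    induction n with
    | zero => simp
    | succ n ih =>
      rw [ascPochhammer_succ_eval, Finset.prod_range_succ,
        ih (Ring.factorial_nsmul_multichoose_eq_ascPochhammer t n)]
  rw [Polynomial.ascPochhammer_smeval_eq_eval, hprod, nsmul_eq_mul] at h
  rw [genD, ← h]
  field_simp

lemma sum_range_genD_div {t : ℝ} (ht : t < 1) (N : ℕ) :
    ∑ n ∈ Finset.range N, genD t n / (n + 1) = (1 - genD t N) / (1 - t) := by
  have h1 : 1 - t ≠ 0 := by linarith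
  induction N with
  | zero => simp [genD]
  | succ N ih =>
    rw [Finset.sum_range_succ, ih, genD_succ]
    field_simp
    ring

lemma summable_genD_div {t : ℝ} (ht0 : 0 < t) (ht1 : t < 1) :
    Summable fun n : ℕ => genD t n / (n + 1) := by
  refine summable_of_sum_range_le (c := 1 / (1 - t))
    (fun n => div_nonneg (genD_nonneg ht0 n) (by positivity)) fun N => ?_
  rw [sum_range_genD_div ht1]
  have := genD_nonneg ht0 N
  gcongr
  linarith

lemma hasSum_genD_mul_pow (t : ℝ) {x : ℝ} (hx : |x| < 1) :
    HasSum (fun n : ℕ => genD t n * x ^ n) ((1 - x) ^ (-t)) := by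
  have h := (Real.one_div_one_sub_rpow_hasFPowerSeriesOnBall_zero t).hasSum (y := x)
    (by simpa [enorm_eq_nnnorm] using! hx)
  rw [Real.rpow_neg (by linarith [le_abs_self x]), ← one_div]
  simpa [genD_eq_choose, mul_comm] using h

lemma hasSum_odd_genD (t : ℝ) {x : ℝ} (hx : |x| < 1) :
    HasSum (fun m : ℕ => 2 * genD t (2 * m + 1) * x ^ (2 * m + 1))
      ((1 - x) ^ (-t) - (1 + x) ^ (-t)) := by
  have h := (hasSum_genD_mul_pow t hx).sub (hasSum_genD_mul_pow t (x := -x) (by rwa [abs_neg]))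
  rw [sub_neg_eq_add] at h
  have hinj : Function.Injective fun m : ℕ => 2 * m + 1 := fun a b hab => by
    simpa using hab
  rw [← hinj.hasSum_iff] at h
  · convert! h using 1
    ext m
    simp only [Function.comp_apply, (odd_two_mul_add_one m).neg_pow]
    ring
  · intro n hn
    have hn : Even n := by
      rw [← Nat.not_odd_iff_even]
      rintro ⟨m, rfl⟩
      exact hn ⟨m, rfl⟩
    simp [hn.neg_pow]

lemma integrableOn_rpow_Ioo {a p : ℝ} (hp : 0 ≤ p) :
    IntegrableOn (fun u : ℝ => u ^ p) (Set.Ioo a 1) :=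
  ((Real.continuous_rpow_const hp).integrableOn_Icc (a := a) (b := 1)).mono_set
    Set.Ioo_subset_Icc_self

lemma setIntegral_rpow_Ioo {a p : ℝ} (ha : a ≤ 1) (hp : 0 ≤ p) :
    ∫ u in Set.Ioo a 1, u ^ p = (1 - a ^ (p + 1)) / (p + 1) := by
  rw [← integral_Ioc_eq_integral_Ioo, ← intervalIntegral.integral_of_le ha,
    integral_rpow (Or.inl (by linarith)), Real.one_rpow]

lemma integrableOn_exp_neg_mul_one_sub_exp {c : ℝ} (hc : 0 < c) :
    IntegrableOn (fun w : ℝ => Real.exp (-w) * (1 - Real.exp (-c * w))) (Set.Ioi 0) := by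
  have h : (fun w : ℝ => Real.exp (-w) * (1 - Real.exp (-c * w))) =
      fun w => Real.exp (-1 * w) - Real.exp (-(1 + c) * w) := by
    ext w
    rw [mul_sub, ← Real.exp_add]
    ring_nf
  rw [h]
  exact (integrableOn_exp_mul_Ioi (by norm_num) 0).sub
    (integrableOn_exp_mul_Ioi (by linarith) 0)

lemma integral_exp_neg_mul_one_sub_exp {c : ℝ} (hc : 0 < c) :
    ∫ w in Set.Ioi (0:ℝ), Real.exp (-w) * (1 - Real.exp (-c * w)) = c / (1 + c) := by
  have h : (fun w : ℝ => Real.exp (-w) * (1 - Real.exp (-c * w))) =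
      fun w => Real.exp (-1 * w) - Real.exp (-(1 + c) * w) := by
    ext w
    rw [mul_sub, ← Real.exp_add]
    ring_nf
  rw [h, integral_sub (integrableOn_exp_mul_Ioi (by norm_num) 0)
    (integrableOn_exp_mul_Ioi (by linarith) 0), integral_exp_mul_Ioi (by norm_num),
    integral_exp_mul_Ioi (by linarith)]
  have : 1 + c ≠ 0 := by linarith
  simp only [mul_zero, Real.exp_zero]
  rw [neg_div_neg_eq]
  field_simp
  ring

lemma summable_odd_genD_div {b t d : ℝ} (hb : 0 < b) (ht0 : 0 < t) (ht1 : t < 1) (hd : 0 ≤ d) :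
    Summable fun m : ℕ => genD t (2 * m + 1) / (((2 * m + 1 : ℕ) + d) * b + 1) := by
  have hinj : Function.Injective fun m : ℕ => 2 * m + 1 := fun a b hab => by
    simpa using hab
  have h := ((summable_genD_div ht0 ht1).comp_injective hinj).mul_left (2 / b)
  refine h.of_nonneg_of_le (fun m => div_nonneg (genD_nonneg ht0 _) (by positivity)) fun m => ?_
  have h0 := genD_nonneg ht0 (2 * m + 1)
  have hbd : 0 ≤ d * b := by positivity
  have hmb : 0 ≤ (m : ℝ) * b := by positivity
  have h2 : 2 / b * (genD t (2 * m + 1) / ((2 * m + 1 : ℕ) + 1)) =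
      genD t (2 * m + 1) / (b * ((2 * m + 1 : ℕ) + 1) / 2) := by
    field_simp
  rw [Function.comp_apply, h2]
  refine div_le_div_of_nonneg_left h0 (by positivity) ?_
  push_cast
  nlinarith

/-- Termwise integration of the inner integrand over `(a, 1)`. -/
lemma integrableOn_and_hasSum_inner {b t a : ℝ} (hb : 0 < b) (ht0 : 0 < t) (ht1 : t < 1)
    (ha0 : 0 ≤ a) (ha1 : a ≤ 1) :
    IntegrableOn (fun u : ℝ => (1 - u ^ b) ^ (-t) - (1 + u ^ b) ^ (-t)) (Set.Ioo a 1) ∧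
    HasSum (fun m : ℕ => 2 * genD t (2 * m + 1) *
        ((1 - a ^ (b * (2 * m + 1 : ℕ) + 1)) / (b * (2 * m + 1 : ℕ) + 1)))
      (∫ u in Set.Ioo a 1, ((1 - u ^ b) ^ (-t) - (1 + u ^ b) ^ (-t))) := by
  have hint : ∀ m : ℕ, ∫ u in Set.Ioo a 1, 2 * genD t (2 * m + 1) * u ^ (b * (2 * m + 1 : ℕ)) =
      2 * genD t (2 * m + 1) *
        ((1 - a ^ (b * (2 * m + 1 : ℕ) + 1)) / (b * (2 * m + 1 : ℕ) + 1)) := fun m => by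
    rw [integral_const_mul, setIntegral_rpow_Ioo ha1 (by positivity)]
  have key := integrable_and_hasSum_integral_of_nonneg (μ := volume.restrict (Set.Ioo a 1))
    (F := fun (m : ℕ) u => 2 * genD t (2 * m + 1) * u ^ (b * (2 * m + 1 : ℕ)))
    (g := fun u : ℝ => (1 - u ^ b) ^ (-t) - (1 + u ^ b) ^ (-t))
    (fun m => (integrableOn_rpow_Ioo (by positivity)).const_mul _) (fun m => ?_) ?_ ?_
  · simpa only [hint, IntegrableOn] using key
  · filter_upwards [ae_restrict_mem measurableSet_Ioo] with u hu
    have := genD_nonneg ht0 (2 * m + 1)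
    have := Real.rpow_nonneg (ha0.trans hu.1.le) (b * (2 * m + 1 : ℕ))
    simp only [Pi.zero_apply]
    positivity
  · filter_upwards [ae_restrict_mem measurableSet_Ioo] with u hu
    have hu0 : 0 ≤ u := ha0.trans hu.1.le
    have := hasSum_odd_genD t (x := u ^ b) (by
      rw [abs_of_nonneg (Real.rpow_nonneg hu0 b)]
      exact Real.rpow_lt_one hu0 hu.2 hb)
    simpa only [← Real.rpow_mul_natCast hu0] using this
  · simp only [hint]
    have hs := (summable_odd_genD_div hb ht0 ht1 le_rfl).mul_left 2
    refine hs.of_nonneg_of_le (fun m => ?_) fun m => ?_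
    all_goals
      have h0 := genD_nonneg ht0 (2 * m + 1)
      have hp : 0 ≤ b * ((2 * m + 1 : ℕ) : ℝ) := by positivity
      have h1 : a ^ (b * ((2 * m + 1 : ℕ) : ℝ) + 1) ≤ 1 :=
        Real.rpow_le_one ha0 ha1 (by linarith)
      have h2 : 0 ≤ a ^ (b * ((2 * m + 1 : ℕ) : ℝ) + 1) := Real.rpow_nonneg ha0 _
    · exact mul_nonneg (by positivity) (div_nonneg (by linarith) (by positivity))
    · rw [add_zero, mul_comm _ b, mul_div_assoc', mul_div_assoc']
      refine div_le_div_of_nonneg_right ?_ (by positivity)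
      exact mul_le_of_le_one_right (by positivity) (by linarith)

/-- For `b > 0` and `0 < t < 1`, the iterated integral
`∫_0^∞ e^{−w} (∫_{e^{−w/b}}^1 [(1−u^b)^{−t} − (1+u^b)^{−t}] du) dw`
is well defined and equals `2 ∑_{n odd, n≥1} D(t,n)/((n+1)b+1)`, the series
(indexed by `m ↦ n = 2m+1`) being convergent. -/
theorem double_integral_eq_two_odd_tsum (b t : ℝ) (hb : 0 < b) (ht0 : 0 < t) (ht1 : t < 1) :
    (∀ w ∈ Set.Ioi (0:ℝ), IntegrableOn
      (fun u : ℝ => (1 - u ^ b) ^ (-t) - (1 + u ^ b) ^ (-t))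
      (Set.Ioo (Real.exp (-w / b)) 1) volume) ∧
    IntegrableOn
      (fun w : ℝ => Real.exp (-w) *
        ∫ u in Set.Ioo (Real.exp (-w / b)) 1, ((1 - u ^ b) ^ (-t) - (1 + u ^ b) ^ (-t)))
      (Set.Ioi 0) volume ∧
    Summable (fun m : ℕ => genD t (2 * m + 1) / (((2 * m + 1 : ℕ) + 1) * b + 1)) ∧
    ∫ w in Set.Ioi (0:ℝ), Real.exp (-w) *
        ∫ u in Set.Ioo (Real.exp (-w / b)) 1, ((1 - u ^ b) ^ (-t) - (1 + u ^ b) ^ (-t))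
      = 2 * ∑' m : ℕ, genD t (2 * m + 1) / (((2 * m + 1 : ℕ) + 1) * b + 1) := by
  have hsum : Summable fun m : ℕ => genD t (2 * m + 1) / (((2 * m + 1 : ℕ) + 1) * b + 1) :=
    summable_odd_genD_div hb ht0 ht1 zero_le_one
  have hinner := fun w (hw : w ∈ Set.Ioi (0:ℝ)) =>
    integrableOn_and_hasSum_inner (a := Real.exp (-w / b)) hb ht0 ht1 (Real.exp_pos _).le
      (Real.exp_le_one_iff.2 (div_nonpos_of_nonpos_of_nonneg (neg_nonpos.2 (le_of_lt hw)) hb.le))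
  have hc : ∀ m : ℕ, 0 < (2 * m + 1 : ℕ) + 1 / b := fun m => by positivity
  have hF : ∀ m : ℕ, ∫ w in Set.Ioi (0:ℝ),
      2 * genD t (2 * m + 1) / (b * (2 * m + 1 : ℕ) + 1) *
        (Real.exp (-w) * (1 - Real.exp (-((2 * m + 1 : ℕ) + 1 / b) * w))) =
      2 * (genD t (2 * m + 1) / (((2 * m + 1 : ℕ) + 1) * b + 1)) := fun m => by
    rw [integral_const_mul, integral_exp_neg_mul_one_sub_exp (hc m)]
    field_simp
    ring
  have key := integrable_and_hasSum_integral_of_nonneg (μ := volume.restrict (Set.Ioi (0:ℝ)))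
    (F := fun (m : ℕ) w => 2 * genD t (2 * m + 1) / (b * (2 * m + 1 : ℕ) + 1) *
      (Real.exp (-w) * (1 - Real.exp (-((2 * m + 1 : ℕ) + 1 / b) * w))))
    (g := fun w : ℝ => Real.exp (-w) *
      ∫ u in Set.Ioo (Real.exp (-w / b)) 1, ((1 - u ^ b) ^ (-t) - (1 + u ^ b) ^ (-t)))
    (fun m => (integrableOn_exp_neg_mul_one_sub_exp (hc m)).const_mul _) (fun m => ?_) ?_ ?_
  · refine ⟨fun w hw => (hinner w hw).1, key.1, hsum, ?_⟩
    rw [← tsum_mul_left, ← key.2.tsum_eq]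
    exact tsum_congr hF
  · filter_upwards [ae_restrict_mem measurableSet_Ioi] with w hw
    have h0 := genD_nonneg ht0 (2 * m + 1)
    have h1 : Real.exp (-((2 * m + 1 : ℕ) + 1 / b) * w) ≤ 1 := by
      rw [Real.exp_le_one_iff, neg_mul, neg_nonpos]
      exact mul_nonneg (hc m).le (le_of_lt hw)
    exact mul_nonneg (by positivity) (mul_nonneg (Real.exp_pos _).le (by linarith))
  · filter_upwards [ae_restrict_mem measurableSet_Ioi] with w hw
    convert! (hinner w hw).2.mul_left (Real.exp (-w)) using 1
    ext m
    rw [← Real.exp_mul, show -w / b * (b * (2 * m + 1 : ℕ) + 1) =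
      -((2 * m + 1 : ℕ) + 1 / b) * w by field_simp]
    ring
  · simp only [hF]
    exact hsum.mul_left 2
end

section
/- For every real K ≥ 2 there exists a real t with 0 < t < 1 such that H1(t;0,K) ≥ 1/12.3, where H1(t;0,K) = −K·log( 1 + ∑_{n even, n≥2} C(t,n)/(n(K−1)+1) ) and C(t,n) = (∏_{l=0}^{n−1}(t−l))/n!, the sum being over even integers n ≥ 2 (the series converges and the quantity inside the logarithm lies in (0,1) for such t). -/
/-- The product `∏_{l=1}^{n} (1 - t/l)`, whose consecutive differences are `|C(t,n)|`
when `0 < t < 1`. -/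
noncomputable def prodOneSubDiv (t : ℝ) (n : ℕ) : ℝ :=
  ∏ l ∈ Finset.range n, (1 - t / ((l : ℝ) + 1))

theorem prodOneSubDiv_succ (t : ℝ) (n : ℕ) :
    prodOneSubDiv t (n + 1) = prodOneSubDiv t n * (1 - t / ((n : ℝ) + 1)) :=
  Finset.prod_range_succ _ _

theorem prodOneSubDiv_nonneg {t : ℝ} (ht : t ≤ 1) (n : ℕ) : 0 ≤ prodOneSubDiv t n := by
  refine Finset.prod_nonneg fun l _ => ?_
  have hl : (0 : ℝ) ≤ l := l.cast_nonneg
  rw [sub_nonneg, div_le_one (by positivity)]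
  linarith

theorem prodOneSubDiv_succ_le {t : ℝ} (h0 : 0 ≤ t) (h1 : t ≤ 1) (n : ℕ) :
    prodOneSubDiv t (n + 1) ≤ prodOneSubDiv t n := by
  rw [prodOneSubDiv_succ]
  refine mul_le_of_le_one_right (prodOneSubDiv_nonneg h1 n) ?_
  have : 0 ≤ t / ((n : ℝ) + 1) := by positivity
  linarith

theorem genC_succ (t : ℝ) (n : ℕ) : genC t (n + 1) = genC t n * ((t - n) / ((n : ℝ) + 1)) := by
  have : (n.factorial : ℝ) ≠ 0 := by positivity
  unfold genC
  rw [Finset.prod_range_succ, Nat.factorial_succ]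
  push_cast
  field_simp

theorem genC_succ_eq_prodOneSubDiv (t : ℝ) (n : ℕ) :
    genC t (n + 1) = (-1) ^ n * (prodOneSubDiv t n - prodOneSubDiv t (n + 1)) := by
  induction n with
  | zero => simp [genC, prodOneSubDiv]
  | succ n ih =>
    rw [genC_succ, ih, prodOneSubDiv_succ t (n + 1), prodOneSubDiv_succ t n]
    push_cast
    field_simp
    ring

theorem neg_genC_even (t : ℝ) (m : ℕ) :
    -genC t (2 * (m + 1)) = prodOneSubDiv t (2 * m + 1) - prodOneSubDiv t (2 * (m + 1)) := by
  rw [show 2 * (m + 1) = (2 * m + 1) + 1 by ring, genC_succ_eq_prodOneSubDiv, pow_succ, pow_mul]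
  norm_num

theorem neg_genC_even_nonneg {t : ℝ} (h0 : 0 ≤ t) (h1 : t ≤ 1) (m : ℕ) :
    0 ≤ -genC t (2 * (m + 1)) := by
  rw [neg_genC_even]
  exact sub_nonneg.2 (prodOneSubDiv_succ_le h0 h1 (2 * m + 1))

theorem sum_neg_genC_even_le_one {t : ℝ} (h0 : 0 ≤ t) (h1 : t ≤ 1) (M : ℕ) :
    ∑ m ∈ Finset.range M, -genC t (2 * (m + 1)) ≤ 1 := by
  calc ∑ m ∈ Finset.range M, -genC t (2 * (m + 1))
      ≤ ∑ m ∈ Finset.range M, (prodOneSubDiv t (2 * m) - prodOneSubDiv t (2 * (m + 1))) := by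
        refine Finset.sum_le_sum fun m _ => ?_
        rw [neg_genC_even]
        linarith [prodOneSubDiv_succ_le h0 h1 (2 * m)]
    _ = prodOneSubDiv t (2 * 0) - prodOneSubDiv t (2 * M) :=
        Finset.sum_range_sub' (fun m => prodOneSubDiv t (2 * m)) M
    _ ≤ 1 := by
        have : prodOneSubDiv t (2 * 0) = 1 := by simp [prodOneSubDiv]
        linarith [prodOneSubDiv_nonneg h1 (2 * M)]

theorem neg_genC_even_succ (t : ℝ) (m : ℕ) :
    -genC t (2 * (m + 1 + 1)) = -genC t (2 * (m + 1)) *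
      (((2 * m + 2 - t) * (2 * m + 3 - t)) / ((2 * m + 3) * (2 * m + 4))) := by
  rw [show 2 * (m + 1 + 1) = 2 * (m + 1) + 1 + 1 by ring, genC_succ, genC_succ]
  push_cast
  field_simp
  ring

/-- A natural number below `-10 ^ 10 * C(5/11, 2 (m + 1))`, computed by truncating division. -/
def scaledLower : ℕ → ℕ
  | 0 => 15 * 10 ^ 10 / 121
  | m + 1 => scaledLower m * ((22 * m + 17) * (22 * m + 28)) / (121 * ((2 * m + 3) * (2 * m + 4)))

theorem scaledLower_le (m : ℕ) :
    (scaledLower m : ℝ) ≤ 10 ^ 10 * -genC (5 / 11) (2 * (m + 1)) := by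
  induction m with
  | zero =>
    refine Nat.cast_div_le.trans ?_
    norm_num [genC, Finset.prod_range_succ, Nat.factorial]
  | succ m ih =>
    refine Nat.cast_div_le.trans ?_
    rw [neg_genC_even_succ, ← mul_assoc (10 ^ 10 : ℝ)]
    push_cast
    calc (scaledLower m : ℝ) * ((22 * m + 17) * (22 * m + 28)) /
          (121 * ((2 * m + 3) * (2 * m + 4)))
        = scaledLower m * (((2 * m + 2 - 5 / 11) * (2 * m + 3 - 5 / 11)) /
          ((2 * m + 3) * (2 * m + 4))) := by
          field_simp
          ring
      _ ≤ _ := by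
          refine mul_le_mul_of_nonneg_right ih (div_nonneg (mul_nonneg ?_ ?_) (by positivity)) <;>
            linarith [(m.cast_nonneg : (0 : ℝ) ≤ m)]

theorem inv_le_sum_neg_genC_div :
    (1 / 12.3 : ℝ) ≤ ∑ m ∈ Finset.range 40, -genC (5 / 11) (2 * (m + 1)) / (2 * ((m : ℝ) + 1)) := by
  have key : 10 ^ 10 * 10 ≤ 123 * ∑ m ∈ Finset.range 40, scaledLower m / (2 * (m + 1)) := by
    norm_num [Finset.sum_range_succ, scaledLower]
  have hsum : ((∑ m ∈ Finset.range 40, scaledLower m / (2 * (m + 1)) : ℕ) : ℝ) ≤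
      10 ^ 10 * ∑ m ∈ Finset.range 40, -genC (5 / 11) (2 * (m + 1)) / (2 * ((m : ℝ) + 1)) := by
    rw [Nat.cast_sum, Finset.mul_sum]
    refine Finset.sum_le_sum fun m _ => Nat.cast_div_le.trans ?_
    push_cast
    rw [← mul_div_assoc]
    gcongr
    exact scaledLower_le m
  have key' : (10 ^ 10 * 10 : ℝ) ≤
      123 * ((∑ m ∈ Finset.range 40, scaledLower m / (2 * (m + 1)) : ℕ) : ℝ) := by
    exact_mod_cast key
  norm_num at key' ⊢
  norm_num at hsum
  linarith

/-- For every real `K ≥ 2` there is `t ∈ (0,1)` with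
`H1(t;0,K) = −K·log(1 + ∑_{n even, n≥2} C(t,n)/(n(K−1)+1)) ≥ 1/12.3`; moreover the series
converges and the quantity inside the logarithm lies in `(0,1)`. -/
theorem exists_t_H1_ge (K : ℝ) (hK : 2 ≤ K) :
    ∃ t : ℝ, 0 < t ∧ t < 1 ∧
      Summable (fun m : ℕ => genC t (2 * (m + 1)) / ((2 * (m + 1) : ℕ) * (K - 1) + 1)) ∧
      (0 < 1 + ∑' m : ℕ, genC t (2 * (m + 1)) / ((2 * (m + 1) : ℕ) * (K - 1) + 1)) ∧
      (1 + ∑' m : ℕ, genC t (2 * (m + 1)) / ((2 * (m + 1) : ℕ) * (K - 1) + 1) < 1) ∧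
      (1 / 12.3 : ℝ) ≤
        -K * Real.log
          (1 + ∑' m : ℕ, genC t (2 * (m + 1)) / ((2 * (m + 1) : ℕ) * (K - 1) + 1)) := by
  have h0 : (0 : ℝ) ≤ 5 / 11 := by norm_num
  have h1 : (5 / 11 : ℝ) ≤ 1 := by norm_num
  set b : ℕ → ℝ := fun m => -genC (5 / 11) (2 * (m + 1)) with hb
  set d : ℕ → ℝ := fun m => ((2 * (m + 1) : ℕ) : ℝ) * (K - 1) + 1 with hd
  have hb0 : ∀ m, 0 ≤ b m := neg_genC_even_nonneg h0 h1
  have hd3 : ∀ m, 3 ≤ d m := fun m => by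
    have hm : (0 : ℝ) ≤ m := m.cast_nonneg
    simp only [hd]
    push_cast
    nlinarith
  have hbs : Summable b := summable_of_sum_range_le hb0 (sum_neg_genC_even_le_one h0 h1)
  have hb1 : ∑' m, b m ≤ 1 := Real.tsum_le_of_sum_range_le hb0 (sum_neg_genC_even_le_one h0 h1)
  have hg0 : ∀ m, 0 ≤ b m / d m := fun m => div_nonneg (hb0 m) (by linarith [hd3 m])
  have hgb : ∀ m, b m / d m ≤ b m / 3 := fun m =>
    div_le_div_of_nonneg_left (hb0 m) (by norm_num) (hd3 m)
  have hgs : Summable fun m => b m / d m := Summable.of_nonneg_of_le hg0 hgb (hbs.div_const 3)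
  have hf : (fun m : ℕ => genC (5 / 11) (2 * (m + 1)) / ((2 * (m + 1) : ℕ) * (K - 1) + 1)) =
      fun m => -(b m / d m) := by
    funext m
    simp only [hb, hd, neg_div, neg_neg]
  have hS1 : ∑' m, b m / d m ≤ 1 / 3 := by
    calc ∑' m, b m / d m ≤ ∑' m, b m / 3 := hgs.tsum_le_tsum hgb (hbs.div_const 3)
      _ = (∑' m, b m) / 3 := tsum_div_const
      _ ≤ 1 / 3 := by linarith
  have hKS : (1 / 12.3 : ℝ) ≤ K * ∑' m, b m / d m := by
    calc (1 / 12.3 : ℝ) ≤ ∑ m ∈ Finset.range 40, b m / (2 * ((m : ℝ) + 1)) :=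
          inv_le_sum_neg_genC_div
      _ ≤ ∑ m ∈ Finset.range 40, K * (b m / d m) := by
          refine Finset.sum_le_sum fun m _ => ?_
          have hm : (0 : ℝ) ≤ m := m.cast_nonneg
          rw [← mul_div_assoc, div_le_div_iff₀ (by positivity) (by linarith [hd3 m]),
            mul_comm K, mul_assoc]
          refine mul_le_mul_of_nonneg_left ?_ (hb0 m)
          simp only [hd]
          push_cast
          linarith
      _ = K * ∑ m ∈ Finset.range 40, b m / d m := (Finset.mul_sum _ _ _).symm
      _ ≤ K * ∑' m, b m / d m :=
          mul_le_mul_of_nonneg_left (hgs.sum_le_tsum _ fun m _ => hg0 m) (by linarith)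
  have hSpos : 0 < ∑' m, b m / d m := by
    by_contra! h
    have : K * ∑' m, b m / d m ≤ 0 := mul_nonpos_of_nonneg_of_nonpos (by linarith) h
    norm_num at hKS
    linarith
  refine ⟨5 / 11, by norm_num, by norm_num, ?_⟩
  rw [hf, tsum_neg]
  refine ⟨hgs.neg, by linarith, by linarith, hKS.trans ?_⟩
  have hlog := Real.log_le_sub_one_of_pos (show 0 < 1 + -∑' m, b m / d m by linarith)
  nlinarith
end
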